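/- arXiv:2006.02265 — 7 statements merged into one kernel-verified Lean document; each statement's English description precedes it below -/
import Mathlib

section
/- Let G be a finite non-abelian group of even order and let t be a non-central element of G such that t^2 is central. Then there exists a non-central element x of G such that |G| ≤ |C_G(t)|^2 · (|C_G(x)| − 1/2). -/
open Finset Subgroup in
open scoped Classical in
theorem card_filter_conj_eq_le_card_centralizer {G : Type*} [Group G] [Fintype G] (w y : G) :
    #{u : G | u * w * u⁻¹ = y} ≤ Nat.card (centralizer ({w} : Set G)) := by
  rcases Finset.eq_empty_or_nonempty ({u : G | u * w * u⁻¹ = y} : Finset G) with h | ⟨v, hv⟩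
  · simp [h]
  · rw [mem_filter_univ] at hv
    rw [← SetLike.coe_sort_coe, Nat.card_eq_card_toFinset (centralizer ({w} : Set G) : Set G)]
    refine card_le_card_of_injOn (fun u => v⁻¹ * u) (fun u hu => ?_)
      ((mul_right_injective v⁻¹).injOn)
    have hu : u * w * u⁻¹ = y := by simpa using hu
    have h : u * w = v * w * v⁻¹ * u := by rw [hv, ← hu]; group
    simp only [Set.coe_toFinset, SetLike.mem_coe, mem_centralizer_singleton_iff]
    rw [mul_assoc, h]
    group

open Subgroup in
theorem sum_card_centralizer {G : Type*} [Group G] [Fintype G] :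
    ∑ w : G, Nat.card (centralizer ({w} : Set G)) =
      Nat.card (ConjClasses G) * Nat.card G := by
  rw [← card_comm_eq_card_conjClasses_mul_card, ← Nat.card_sigma]
  refine Nat.card_congr
    ⟨fun p => ⟨(p.2.1, p.1), mem_centralizer_singleton_iff.mp p.2.2⟩,
      fun p => ⟨p.1.2, p.1.1, mem_centralizer_singleton_iff.mpr p.2⟩,
      fun _ => rfl, fun _ => rfl⟩

open Finset Subgroup in
open scoped Classical in
theorem card_dvd_sum_noncentral_card_centralizer (G : Type*) [Group G] [Fintype G] :
    Nat.card G ∣ ∑ w : G with w ∉ center G, Nat.card (centralizer ({w} : Set G)) := by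
  have hsum := sum_filter_add_sum_filter_not univ (· ∈ center G)
    (fun w : G => Nat.card (centralizer ({w} : Set G)))
  have hcentral : ∑ w : G with w ∈ center G, Nat.card (centralizer ({w} : Set G)) =
      #{w : G | w ∈ center G} * Nat.card G := by
    refine sum_const_nat fun w hw => ?_
    rw [mem_filter_univ] at hw
    rw [centralizer_eq_top_iff_subset.mpr (by simpa using hw), card_top]
  rw [sum_card_centralizer, hcentral] at hsum
  exact (Nat.dvd_add_right (Dvd.intro_left _ rfl)).mp (hsum ▸ Dvd.intro_left _ rfl)

open Finset Subgroup in
open scoped Classical in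
/-- If every centralizer of a non-central element has order at most `m`, then the number of
non-central conjugacy classes is less than `m`. -/
theorem sum_noncentral_card_centralizer_le {G : Type*} [Group G] [Fintype G] {m : ℕ}
    (hm : ∀ w : G, w ∉ center G → Nat.card (centralizer ({w} : Set G)) ≤ m) (hpos : 0 < m) :
    ∑ w : G with w ∉ center G, Nat.card (centralizer ({w} : Set G)) ≤ Nat.card G * (m - 1) := by
  obtain ⟨r, hr⟩ := card_dvd_sum_noncentral_card_centralizer G
  have hle : ∑ w : G with w ∉ center G, Nat.card (centralizer ({w} : Set G)) ≤
      #{w : G | w ∉ center G} * m :=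
    sum_le_card_nsmul _ _ _ fun w hw => hm w (mem_filter_univ w |>.mp hw)
  have hcard : #{w : G | w ∉ center G} < Nat.card G := by
    rw [Nat.card_eq_fintype_card]
    exact card_lt_univ_of_notMem (x := 1) (by simp [one_mem])
  have hlt : Nat.card G * r < Nat.card G * m :=
    hr ▸ hle.trans_lt (Nat.mul_lt_mul_of_pos_right hcard hpos)
  rw [hr]
  exact Nat.mul_le_mul_left _ (Nat.le_sub_one_of_lt (Nat.lt_of_mul_lt_mul_left hlt))

open Finset Subgroup in
open scoped Classical in
theorem card_conjugates_mul_card_centralizer {G : Type*} [Group G] [Fintype G] (t : G) :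
    #{u : G | IsConj u t} * Nat.card (centralizer ({t} : Set G)) = Nat.card G := by
  rw [nat_card_centralizer_nat_card_stabilizer, Nat.card_eq_fintype_card,
    Nat.card_eq_fintype_card, ← ConjAct.card (G := G),
    ← MulAction.card_orbit_mul_card_stabilizer_eq_card_group (ConjAct G) t]
  congr 1
  rw [← Set.toFinset_card]
  congr 1
  ext u
  simp [ConjAct.mem_orbit_conjAct]

open Finset Subgroup in
open scoped Classical in
/-- If `t ^ 2` is central, then the conjugates `u` of `t` for which `u⁻¹ * w` is again a conjugate
of `t` all conjugate `w` to the same element `t ^ 4 * w⁻¹`. -/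
theorem card_conjugate_pairs_mul_eq_le {G : Type*} [Group G] [Fintype G] {t : G}
    (ht2 : t ^ 2 ∈ center G) (w : G) :
    #{p ∈ ({u : G | IsConj u t} : Finset G) ×ˢ ({u : G | IsConj u t} : Finset G) |
      p.1 * p.2 = w} ≤ Nat.card (centralizer ({w} : Set G)) := by
  have hsq : ∀ u, IsConj u t → u * u = t ^ 2 := fun u hu => by
    obtain ⟨c, hc⟩ := isConj_iff.mp hu.symm
    rw [← hc, ← sq, conj_pow, mem_center_iff.mp ht2 c, mul_inv_cancel_right]
  refine le_trans ?_ (card_filter_conj_eq_le_card_centralizer w (t ^ 2 * t ^ 2 * w⁻¹))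
  refine card_le_card_of_injOn Prod.fst ?_ ?_
  · rintro ⟨u, v⟩ h
    simp only [coe_filter, mem_product, mem_filter_univ, Set.mem_ofPred_eq] at h ⊢
    obtain ⟨⟨hu, hv⟩, rfl⟩ := h
    have h1 := hsq u hu
    have h2 := hsq v hv
    refine ⟨mem_univ _, ?_⟩
    calc u * (u * v) * u⁻¹ = (u * u) * v * u⁻¹ := by group
      _ = t ^ 2 * (v * v) * v⁻¹ * u⁻¹ := by rw [h1]; group
      _ = t ^ 2 * t ^ 2 * (u * v)⁻¹ := by rw [h2]; group
  · rintro ⟨u, v⟩ h ⟨u', v'⟩ h' (rfl : u = u')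
    simp only [coe_filter, Set.mem_ofPred_eq] at h h'
    rw [Prod.mk.injEq]
    exact ⟨rfl, mul_left_cancel (h.2.trans h'.2.symm)⟩

open Finset Subgroup in
open scoped Classical in
theorem card_conjugates_sq_le {G : Type*} [Group G] [Fintype G] {t : G}
    (ht2 : t ^ 2 ∈ center G) :
    #{u : G | IsConj u t} ^ 2 ≤ #{u : G | IsConj u t} * Nat.card (center G) +
      ∑ w : G with w ∉ center G, Nat.card (centralizer ({w} : Set G)) := by
  set K : Finset G := {u : G | IsConj u t}
  have hfib := card_eq_sum_card_fiberwise (s := K ×ˢ K) (t := univ)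
    (f := fun p => p.1 * p.2) (fun _ _ => mem_coe.mpr (mem_univ _))
  rw [card_product, ← sq, ← sum_filter_add_sum_filter_not univ (· ∈ center G)] at hfib
  rw [hfib]
  refine add_le_add ?_ (sum_le_sum fun w _ => card_conjugate_pairs_mul_eq_le ht2 w)
  have hcard : #{w : G | w ∈ center G} = Nat.card (center G) := by
    rw [Nat.card_eq_fintype_card, Fintype.card_subtype]
  rw [mul_comm, ← hcard, ← smul_eq_mul]
  refine sum_le_card_nsmul _ _ _ fun w _ => card_le_card_of_injOn Prod.fst ?_ ?_
  · rintro ⟨u, v⟩ h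
    simp only [coe_filter, mem_product, Set.mem_ofPred_eq] at h
    exact h.1.1
  · rintro ⟨u, v⟩ h ⟨u', v'⟩ h' (rfl : u = u')
    simp only [coe_filter, Set.mem_ofPred_eq] at h h'
    rw [Prod.mk.injEq]
    exact ⟨rfl, mul_left_cancel (h.2.trans h'.2.symm)⟩

open Subgroup in
theorem two_mul_card_center_le_card_centralizer {G : Type*} [Group G] [Finite G] {t : G}
    (ht : t ∉ center G) :
    2 * Nat.card (center G) ≤ Nat.card (centralizer ({t} : Set G)) := by
  have hle : center G ≤ centralizer ({t} : Set G) := center_le_centralizer _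
  obtain ⟨c, hc⟩ := card_dvd_of_le hle
  have hpos : 0 < Nat.card (centralizer ({t} : Set G)) := Nat.card_pos
  have h1 : c ≠ 1 := fun h => ht <| by
    rw [eq_of_le_of_card_ge hle (by rw [hc, h, mul_one])]
    exact mem_centralizer_singleton_iff.mpr rfl
  have h0 : c ≠ 0 := fun h => by simp [hc, h] at hpos
  rw [hc, mul_comm]
  exact Nat.mul_le_mul_left _ (by omega)

/-- If `G` is a finite non-abelian group of even order and `t` is a non-central element
with `t^2` central, then there is a non-central `x` with
`|G| ≤ |C_G(t)|^2 * (|C_G(x)| - 1/2)` (as rationals). -/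
theorem stmt_1 (G : Type*) [Group G] [Finite G]
    (hna : ∃ a b : G, a * b ≠ b * a)
    (heven : Even (Nat.card G))
    (t : G) (ht : t ∉ Subgroup.center G) (ht2 : t ^ 2 ∈ Subgroup.center G) :
    ∃ x : G, x ∉ Subgroup.center G ∧
      (Nat.card G : ℚ) ≤ (Nat.card (Subgroup.centralizer ({t} : Set G))) ^ 2 *
        ((Nat.card (Subgroup.centralizer ({x} : Set G)) : ℚ) - 1 / 2) := by
  classical
  have := Fintype.ofFinite G
  obtain ⟨x, hx, hmax⟩ := Set.exists_max_image {w : G | w ∉ Subgroup.center G}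
    (fun w => Nat.card (Subgroup.centralizer ({w} : Set G))) (Set.toFinite _) ⟨t, ht⟩
  refine ⟨x, hx, ?_⟩
  have hmpos : 0 < Nat.card (Subgroup.centralizer ({x} : Set G)) := Nat.card_pos
  have hsum := (card_conjugates_sq_le ht2).trans
    (Nat.add_le_add_left (sum_noncentral_card_centralizer_le hmax hmpos) _)
  have hcenter := two_mul_card_center_le_card_centralizer ht
  have hclass := card_conjugates_mul_card_centralizer t
  have hgpos : 0 < Nat.card G := Nat.card_pos
  generalize Nat.card (Subgroup.centralizer ({x} : Set G)) = m at *
  generalize Nat.card (Subgroup.centralizer ({t} : Set G)) = k at *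
  generalize Finset.card _ = n at *
  obtain ⟨m, rfl⟩ := Nat.exists_eq_succ_of_ne_zero hmpos.ne'
  rw [← hclass] at hsum hgpos ⊢
  have hn : 0 < n := Nat.pos_of_mul_pos_right hgpos
  have hle : n ≤ Nat.card (Subgroup.center G) + k * m := by
    refine Nat.le_of_mul_le_mul_left ?_ hn
    simp only [Nat.succ_eq_add_one, Nat.add_sub_cancel] at hsum
    nlinarith
  have hnat : 2 * (n * k) ≤ k ^ 2 * (2 * m + 1) := by nlinarith
  have hrat : (2 : ℚ) * (n * k) ≤ k ^ 2 * (2 * m + 1) := by exact_mod_cast hnat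
  push_cast
  linarith
end

section
/- Let G be a finite group and let t ∈ G be an element such that t^2 is central. Define W = {(x,y) ∈ t^G × G : x^{-1}yx = y^{-1}}. Then |W| ≥ |t^G|^2, i.e. |W| ≥ |G|^2 / |C_G(t)|^2. -/
/-- Elements whose squares agree: `x` inverts `x * u⁻¹`. -/
theorem inv_mul_mul_inv_mul_self_of_sq_eq {G : Type*} [Group G] {x u : G} (hxu : x ^ 2 = u ^ 2) :
    x⁻¹ * (x * u⁻¹) * x = (x * u⁻¹)⁻¹ := by
  have h : x * x = u * u := by simpa only [pow_two] using hxu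
  calc x⁻¹ * (x * u⁻¹) * x = u⁻¹ * (x * x) * x⁻¹ := by group
    _ = u⁻¹ * (u * u) * x⁻¹ := by rw [h]
    _ = (x * u⁻¹)⁻¹ := by group

/-- Conjugation preserves a central square. -/
theorem conj_sq_eq_of_sq_mem_center {G : Type*} [Group G] {t : G}
    (ht : t ^ 2 ∈ Subgroup.center G) (g : G) : (g⁻¹ * t * g) ^ 2 = t ^ 2 := by
  have hcomm : g * t ^ 2 = t ^ 2 * g := Subgroup.mem_center_iff.mp ht g
  calc (g⁻¹ * t * g) ^ 2 = g⁻¹ * (t ^ 2 * g) := by rw [pow_two, pow_two]; group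
    _ = t ^ 2 := by rw [← hcomm, inv_mul_cancel_left]

/-- The orbit-stabilizer formula for a conjugacy class. -/
theorem card_conj_mul_card_centralizer {G : Type*} [Group G] (t : G) :
    Nat.card {c : G | ∃ g : G, c = g⁻¹ * t * g} *
      Nat.card (Subgroup.centralizer ({t} : Set G)) = Nat.card G := by
  have horbit : {c : G | ∃ g : G, c = g⁻¹ * t * g} = MulAction.orbit (ConjAct G) t := by
    ext c
    rw [ConjAct.mem_orbit_conjAct, isConj_comm, isConj_iff]
    refine ⟨fun ⟨g, hg⟩ => ⟨g⁻¹, by simp [hg]⟩, fun ⟨g, hg⟩ => ⟨g⁻¹, by simp [← hg]⟩⟩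
  rw [horbit, Subgroup.nat_card_centralizer_nat_card_stabilizer, Nat.card_coe_set_eq,
    ← MulAction.index_stabilizer, Subgroup.index_mul_card]
  exact Nat.card_congr ConjAct.ofConjAct.toEquiv

/-- For a finite group `G` and `t ∈ G` with `t^2` central, the set
`W = {(x,y) ∈ t^G × G : x⁻¹yx = y⁻¹}` satisfies `|W| ≥ |t^G|^2`, i.e.
`|W| ≥ |G|^2 / |C_G(t)|^2`. -/
theorem stmt_5 (G : Type*) [Group G] [Finite G]
    (t : G) (ht2 : t ^ 2 ∈ Subgroup.center G) :
    (Nat.card {c : G | ∃ g : G, c = g⁻¹ * t * g}) ^ 2 ≤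
      Nat.card {p : G × G | (∃ g : G, p.1 = g⁻¹ * t * g) ∧ p.1⁻¹ * p.2 * p.1 = p.2⁻¹} ∧
    ((Nat.card G : ℚ) ^ 2 / (Nat.card (Subgroup.centralizer ({t} : Set G))) ^ 2 ≤
      Nat.card {p : G × G | (∃ g : G, p.1 = g⁻¹ * t * g) ∧ p.1⁻¹ * p.2 * p.1 = p.2⁻¹}) := by
  have hW : (Nat.card {c : G | ∃ g : G, c = g⁻¹ * t * g}) ^ 2 ≤ Nat.card
      {p : G × G | (∃ g : G, p.1 = g⁻¹ * t * g) ∧ p.1⁻¹ * p.2 * p.1 = p.2⁻¹} := by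
    rw [pow_two, ← Nat.card_prod]
    refine Nat.card_le_card_of_injective
      (fun q => ⟨(q.1.1, q.1.1 * q.2.1⁻¹), q.1.2, ?_⟩) ?_
    · obtain ⟨⟨x, g, rfl⟩, ⟨u, k, rfl⟩⟩ := q
      exact inv_mul_mul_inv_mul_self_of_sq_eq
        ((conj_sq_eq_of_sq_mem_center ht2 g).trans (conj_sq_eq_of_sq_mem_center ht2 k).symm)
    · rintro ⟨⟨x, hx⟩, ⟨u, hu⟩⟩ ⟨⟨x', hx'⟩, ⟨u', hu'⟩⟩ h
      simp only [Subtype.mk.injEq, Prod.mk.injEq] at h ⊢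
      obtain ⟨rfl, h⟩ := h
      exact ⟨rfl, inv_injective (mul_left_cancel h)⟩
  refine ⟨hW, ?_⟩
  have hC : (Nat.card (Subgroup.centralizer ({t} : Set G)) : ℚ) ≠ 0 :=
    Nat.cast_ne_zero.mpr Nat.card_pos.ne'
  rw [← card_conj_mul_card_centralizer t, Nat.cast_mul, mul_pow,
    mul_div_cancel_right₀ _ (pow_ne_zero 2 hC)]
  exact_mod_cast hW
end

section
/- Let G be a finite group, let t ∈ G be a non-central element such that t^2 is central, and set W = {(x,y) ∈ t^G × G : x^{-1}yx = y^{-1}}, Z = Z(G). Then |W| ≤ (1 + i(Z))·|G|/|C_G(t)| + (k(G) − |Z|)·|G|, where i(Z) is the number of involutions in Z and k(G) is the number of conjugacy classes of G. -/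
/-- The number of pairs satisfying a relation, counted along the second coordinate. -/
theorem Nat.card_pair_eq_sum_card_fst {α β : Type*} [Finite α] [Fintype β] (r : α → β → Prop) :
    Nat.card {p : α × β | r p.1 p.2} = ∑ y, Nat.card {x | r x y} := by
  rw [← Nat.card_sigma]
  exact Nat.card_congr
    { toFun := fun p => ⟨p.1.2, p.1.1, p.2⟩
      invFun := fun q => ⟨(q.2.1, q.1), q.2.2⟩
      left_inv := fun _ => rfl
      right_inv := fun _ => rfl }

/-- The number of conjugates of `t` times the order of its centralizer is the group order. -/
theorem card_conjugates_mul_card_centralizer_s6 {G : Type*} [Group G] (t : G) :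
    Nat.card {x : G | ∃ g : G, x = g⁻¹ * t * g} *
      Nat.card (Subgroup.centralizer ({t} : Set G)) = Nat.card G := by
  have h : {x : G | ∃ g : G, x = g⁻¹ * t * g} = MulAction.orbit (ConjAct G) t := by
    ext x
    rw [ConjAct.mem_orbit_conjAct, isConj_comm, isConj_iff]
    constructor
    · rintro ⟨g, rfl⟩
      exact ⟨g⁻¹, by simp⟩
    · rintro ⟨g, rfl⟩
      exact ⟨g⁻¹, by simp⟩
  rw [h, Subgroup.nat_card_centralizer_nat_card_stabilizer, ← Nat.card_prod]
  exact Nat.card_congr (MulAction.orbitProdStabilizerEquivGroup (ConjAct G) t)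

/-- At most as many elements invert `y` as commute with `y`. -/
theorem card_inverting_le_card_commuting {G : Type*} [Group G] [Finite G] (T : Set G) (y : G) :
    Nat.card {x : G | x ∈ T ∧ x⁻¹ * y * x = y⁻¹} ≤ Nat.card {x : G | Commute x y} := by
  rcases isEmpty_or_nonempty {x : G | x ∈ T ∧ x⁻¹ * y * x = y⁻¹} with h | ⟨x₀, -, h₀⟩
  · simp
  · refine Nat.card_le_card_of_injective
      (fun x => ⟨x.1 * x₀⁻¹, ?_⟩) fun a b hab => ?_
    · have hx : x.1⁻¹ * y * x.1 = x₀⁻¹ * y * x₀ := x.2.2.trans h₀.symm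
      change x.1 * x₀⁻¹ * y = y * (x.1 * x₀⁻¹)
      calc x.1 * x₀⁻¹ * y = x.1 * (x₀⁻¹ * y * x₀) * x₀⁻¹ := by group
        _ = y * (x.1 * x₀⁻¹) := by rw [← hx]; group
    · exact Subtype.ext (mul_right_cancel (Subtype.ext_iff.mp hab))

/-- Counting pairs `(x, y)` with `x ∈ T` inverting `y`, according to whether `y` is central. -/
theorem card_inverting_pairs_add_le {G : Type*} [Group G] [Finite G] (T : Set G) :
    Nat.card {p : G × G | p.1 ∈ T ∧ p.1⁻¹ * p.2 * p.1 = p.2⁻¹} +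
        Nat.card (Subgroup.center G) * Nat.card G ≤
      Nat.card {z : G | z ∈ Subgroup.center G ∧ z ^ 2 = 1} * Nat.card T +
        Nat.card (ConjClasses G) * Nat.card G := by
  classical
  have := Fintype.ofFinite G
  have hcomm : Nat.card (ConjClasses G) * Nat.card G = ∑ y : G, Nat.card {x : G | Commute x y} := by
    rw [← card_comm_eq_card_conjClasses_mul_card]
    exact Nat.card_pair_eq_sum_card_fst fun x y : G => Commute x y
  have hcard (p : G → Prop) (n : ℕ) : Nat.card {z | p z} * n = ∑ y : G, if p y then n else 0 := by
    rw [← Finset.sum_filter, Finset.sum_const, smul_eq_mul, ← Fintype.card_subtype,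
      ← Nat.card_eq_fintype_card]
    rfl
  have hcenter : Nat.card (Subgroup.center G) * Nat.card G =
      ∑ y : G, if y ∈ Subgroup.center G then Nat.card G else 0 := by
    convert! hcard (· ∈ Subgroup.center G) (Nat.card G)
  rw [Nat.card_pair_eq_sum_card_fst (fun x y : G => x ∈ T ∧ x⁻¹ * y * x = y⁻¹), hcomm, hcenter,
    hcard, ← Finset.sum_add_distrib, ← Finset.sum_add_distrib]
  refine Finset.sum_le_sum fun y _ => ?_
  by_cases hy : y ∈ Subgroup.center G
  · have hxy (x : G) : Commute x y := Subgroup.mem_center_iff.mp hy x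
    have hall : Nat.card {x : G | Commute x y} = Nat.card G := by simp [hxy]
    rw [hall, if_pos hy]
    gcongr
    split_ifs with h
    · exact Nat.card_mono (Set.toFinite T) fun x hx => hx.1
    · refine (Nat.card_eq_zero.mpr (Or.inl ⟨fun x => h ⟨hy, ?_⟩⟩)).le
      have hx := x.2.2
      rw [mul_assoc, ← (hxy x.1).eq, inv_mul_cancel_left] at hx
      rw [sq]
      nth_rewrite 1 [hx]
      exact inv_mul_cancel y
  · simpa [hy] using card_inverting_le_card_commuting T y

/-- The central solutions of `z ^ 2 = 1` are the identity and the central involutions. -/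
theorem card_center_sq_eq_one {G : Type*} [Group G] [Finite G] :
    Nat.card {z : G | z ∈ Subgroup.center G ∧ z ^ 2 = 1} =
      1 + Nat.card {z : G | z ∈ Subgroup.center G ∧ z ^ 2 = 1 ∧ z ≠ 1} := by
  have h : {z : G | z ∈ Subgroup.center G ∧ z ^ 2 = 1} =
      insert 1 {z : G | z ∈ Subgroup.center G ∧ z ^ 2 = 1 ∧ z ≠ 1} := by
    ext z
    by_cases hz : z = 1 <;> simp [hz, one_mem]
  rw [h, Nat.card_coe_set_eq, Nat.card_coe_set_eq, Set.ncard_insert_of_notMem (by simp), add_comm]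


/-- For a finite group `G`, a non-central `t` with `t^2` central, and
`W = {(x,y) ∈ t^G × G : x⁻¹yx = y⁻¹}`, one has
`|W| ≤ (1 + i(Z))·|G|/|C_G(t)| + (k(G) − |Z|)·|G|` (as rationals), where `Z = Z(G)`,
`i(Z)` is the number of involutions in `Z` and `k(G)` the number of conjugacy classes. -/
theorem stmt_6 (G : Type*) [Group G] [Finite G]
    (t : G) (ht : t ∉ Subgroup.center G) (ht2 : t ^ 2 ∈ Subgroup.center G) :
    (Nat.card {p : G × G | (∃ g : G, p.1 = g⁻¹ * t * g) ∧ p.1⁻¹ * p.2 * p.1 = p.2⁻¹} : ℚ) ≤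
      (1 + (Nat.card {z : G | z ∈ Subgroup.center G ∧ z ^ 2 = 1 ∧ z ≠ 1} : ℚ)) *
          Nat.card G / Nat.card (Subgroup.centralizer ({t} : Set G)) +
        ((Nat.card (ConjClasses G) : ℚ) - Nat.card (Subgroup.center G)) * Nat.card G := by
  have hle := card_inverting_pairs_add_le {x : G | ∃ g : G, x = g⁻¹ * t * g}
  rw [card_center_sq_eq_one] at hle
  have hT := card_conjugates_mul_card_centralizer_s6 t
  have hC : (Nat.card (Subgroup.centralizer ({t} : Set G)) : ℚ) ≠ 0 :=
    Nat.cast_ne_zero.mpr Nat.card_pos.ne'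
  have hdiv : (Nat.card G : ℚ) / Nat.card (Subgroup.centralizer ({t} : Set G)) =
      Nat.card {x : G | ∃ g : G, x = g⁻¹ * t * g} := by
    rw [div_eq_iff hC]
    exact_mod_cast hT.symm
  rw [mul_div_assoc, hdiv, sub_mul]
  have hleQ := (Nat.cast_le (α := ℚ)).mpr hle
  push_cast at hleQ
  simp only [Set.mem_ofPred_eq] at hleQ
  linarith
end

section
/- Let G be a finite non-abelian group and let x be a non-central element of G whose centralizer has maximal order among centralizers of non-central elements, i.e. |C_G(x)| = max{|C_G(y)| : y ∈ G \ Z(G)}. Then k(G) − |Z(G)| ≤ |C_G(x)| − 1, where k(G) is the number of conjugacy classes of G. -/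
/-- The number of commuting pairs, counted through centralizers. -/
theorem sum_card_centralizer_eq_card_conjClasses_mul_card (G : Type*) [Group G] [Fintype G] :
    ∑ g : G, Nat.card (Subgroup.centralizer ({g} : Set G)) =
      Nat.card (ConjClasses G) * Nat.card G := by
  rw [← card_comm_eq_card_conjClasses_mul_card, ← Nat.card_sigma]
  exact Nat.card_congr
    { toFun := fun p => ⟨(p.1, p.2.1), Subgroup.mem_centralizer_singleton_iff.1 p.2.2 |>.symm⟩
      invFun := fun p => ⟨p.1.1, p.1.2, Subgroup.mem_centralizer_singleton_iff.2 p.2.symm⟩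
      left_inv := fun _ => rfl
      right_inv := fun _ => rfl }

/-- If all centralizers of non-central elements have order at most `m`, then
`k(G) |G| + |Z(G)| m ≤ |Z(G)| |G| + |G| m`. -/
theorem card_conjClasses_mul_card_add_le (G : Type*) [Group G] [Finite G] (m : ℕ)
    (hm : ∀ y : G, y ∉ Subgroup.center G →
      Nat.card (Subgroup.centralizer ({y} : Set G)) ≤ m) :
    Nat.card (ConjClasses G) * Nat.card G + Nat.card (Subgroup.center G) * m ≤
      Nat.card (Subgroup.center G) * Nat.card G + Nat.card G * m := by
  classical
  cases nonempty_fintype G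
  have hcenter (a : ℕ) : ∑ g : G, (if g ∈ Subgroup.center G then a else 0) =
      Nat.card (Subgroup.center G) * a := by
    rw [← Finset.sum_filter, Finset.sum_const, smul_eq_mul, Nat.card_eq_fintype_card,
      Fintype.card_subtype]
  have hall : ∑ _g : G, m = Nat.card G * m := by simp
  rw [← sum_card_centralizer_eq_card_conjClasses_mul_card, ← hcenter, ← hcenter, ← hall,
    ← Finset.sum_add_distrib, ← Finset.sum_add_distrib]
  refine Finset.sum_le_sum fun g _ => ?_
  split_ifs with hg
  · exact Nat.add_le_add_right (Subgroup.card_le_card_group _) m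
  · simpa using hm g hg


/-- For a finite non-abelian group `G` and a non-central `x` whose centralizer has
maximal order among centralizers of non-central elements,
`k(G) − |Z(G)| ≤ |C_G(x)| − 1` (as integers). -/
theorem stmt_7 (G : Type*) [Group G] [Finite G]
    (hna : ∃ a b : G, a * b ≠ b * a)
    (x : G) (hx : x ∉ Subgroup.center G)
    (hmax : ∀ y : G, y ∉ Subgroup.center G →
      Nat.card (Subgroup.centralizer ({y} : Set G)) ≤
        Nat.card (Subgroup.centralizer ({x} : Set G))) :
    (Nat.card (ConjClasses G) : ℤ) - Nat.card (Subgroup.center G) ≤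
      (Nat.card (Subgroup.centralizer ({x} : Set G)) : ℤ) - 1 := by
  have hle := card_conjClasses_mul_card_add_le G _ hmax
  set m := Nat.card (Subgroup.centralizer ({x} : Set G))
  have hm : 0 < m := Nat.card_pos
  have hz : 0 < Nat.card (Subgroup.center G) := Nat.card_pos
  have hlt : Nat.card (ConjClasses G) < Nat.card (Subgroup.center G) + m := by
    refine Nat.lt_of_mul_lt_mul_right (a := Nat.card G) ?_
    linarith [Nat.mul_pos hz hm]
  omega
end

section
/- Let G be a finite non-abelian group, let t be a non-central element of G with t^2 central, and let x be a non-central element of G whose centralizer has maximal order among centralizers of non-central elements. Then |G| ≤ |C_G(t)|^2 · (|C_G(x)| − 1 + |Z(G)|/|C_G(t)|), equivalently |G|·|C_G(t)| ≤ |C_G(t)|^3·(|C_G(x)| − 1) + |C_G(t)|^2·|Z(G)|. -/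
open Finset in
open Classical in
theorem card_isConj_mul_card_centralizer {G : Type*} [Group G] [Fintype G] (t : G) :
    #{b | IsConj t b} * Nat.card (Subgroup.centralizer ({t} : Set G)) = Nat.card G := by
  rw [Subgroup.nat_card_centralizer_nat_card_stabilizer,
    Nat.card_congr (ConjAct.toConjAct (G := G)).toEquiv,
    ← Nat.card_congr (MulAction.orbitProdStabilizerEquivGroup (ConjAct G) t), Nat.card_prod]
  congr 1
  rw [Nat.card_eq_fintype_card, Fintype.card_subtype]
  congr 1
  ext b
  simp [-isConj_iff, ConjAct.mem_orbit_conjAct, isConj_comm]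

theorem IsConj.card_centralizer_eq {G : Type*} [Group G] [Finite G] {a b : G}
    (h : IsConj a b) :
    Nat.card (Subgroup.centralizer ({a} : Set G)) =
      Nat.card (Subgroup.centralizer ({b} : Set G)) := by
  classical
  have := Fintype.ofFinite G
  have ha := card_isConj_mul_card_centralizer a
  have hb := card_isConj_mul_card_centralizer b
  have hab : (Finset.univ.filter fun c => IsConj a c) =
      Finset.univ.filter fun c => IsConj b c := by
    ext c
    simpa [-isConj_iff] using ⟨h.symm.trans, h.trans⟩
  rw [← hab, ← ha] at hb
  have hpos : 0 < (Finset.univ.filter fun c => IsConj a c).card :=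
    Finset.card_pos.mpr ⟨a, by simpa [-isConj_iff] using IsConj.refl a⟩
  exact (Nat.eq_of_mul_eq_mul_left hpos hb).symm

theorem IsConj.mem_center_of_mem_center {G : Type*} [Group G] {a b : G} (h : IsConj a b)
    (ha : a ∈ Subgroup.center G) : b ∈ Subgroup.center G := by
  obtain ⟨c, rfl⟩ := isConj_iff.mp h
  exact (inferInstance : (Subgroup.center G).Normal).conj_mem a ha c

open Finset in
open Classical in
/-- Summing centralizer orders over the non-central elements counts `|G|` once for each
non-central conjugacy class. -/
theorem sum_card_centralizer_eq {G : Type*} [Group G] [Fintype G] :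
    ∑ y : G with y ∉ Subgroup.center G, Nat.card (Subgroup.centralizer ({y} : Set G)) =
      #(image ConjClasses.mk {y : G | y ∉ Subgroup.center G}) * Nat.card G := by
  rw [← sum_fiberwise_of_maps_to (g := ConjClasses.mk)
    (t := image ConjClasses.mk {y : G | y ∉ Subgroup.center G})
    fun y hy => mem_image_of_mem _ hy]
  refine sum_const_nat fun k hk => ?_
  obtain ⟨y, hy, rfl⟩ := mem_image.mp hk
  replace hy : y ∉ Subgroup.center G := by simpa using hy
  rw [← card_isConj_mul_card_centralizer y]
  have hfib : ({y : G | y ∉ Subgroup.center G} : Finset G).filter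
      (fun z => ConjClasses.mk z = ConjClasses.mk y) = ({z | IsConj y z} : Finset G) := by
    ext z
    simp only [mem_filter, mem_univ, true_and, ConjClasses.mk_eq_mk_iff_isConj]
    exact ⟨fun h => h.2.symm, fun h => ⟨fun hz => hy (h.symm.mem_center_of_mem_center hz), h.symm⟩⟩
  rw [hfib]
  refine sum_const_nat fun z hz => ?_
  exact ((mem_filter.mp hz).2.card_centralizer_eq).symm

open Finset in
open Classical in
/-- If every centralizer of a non-central element has order at most `m`, then there are fewer
than `m` non-central conjugacy classes. -/
theorem sum_card_centralizer_add_card_le {G : Type*} [Group G] [Fintype G] {m : ℕ} (hm : 0 < m)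
    (h : ∀ y : G, y ∉ Subgroup.center G →
      Nat.card (Subgroup.centralizer ({y} : Set G)) ≤ m) :
    ∑ y : G with y ∉ Subgroup.center G, Nat.card (Subgroup.centralizer ({y} : Set G)) +
      Nat.card G ≤ m * Nat.card G := by
  have hlt : #{y : G | y ∉ Subgroup.center G} < Nat.card G := by
    rw [Nat.card_eq_fintype_card]
    exact card_lt_univ_of_notMem (x := 1) (by simp [one_mem])
  have hle := sum_le_card_nsmul {y : G | y ∉ Subgroup.center G}
    (fun y => Nat.card (Subgroup.centralizer ({y} : Set G))) m
    fun y hy => h y (by simpa using hy)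
  rw [sum_card_centralizer_eq] at hle ⊢
  rw [smul_eq_mul] at hle
  have : #(image ConjClasses.mk {y : G | y ∉ Subgroup.center G}) < m :=
    lt_of_mul_lt_mul_right (a := Nat.card G) (by nlinarith) (Nat.zero_le _)
  nlinarith

/-- If right multiplication by `y` preserves the square of `a`, then conjugation by `a`
inverts `y`. -/
theorem mul_mul_eq_of_sq_eq {G : Type*} [Group G] {a y : G} (h : (a * y) ^ 2 = a ^ 2) :
    y * a * y = a := by
  rw [pow_two, pow_two, mul_assoc, mul_right_inj] at h
  rwa [mul_assoc]

theorem inv_mul_mem_centralizer {G : Type*} [Group G] {a b y : G} (ha : y * a * y = a)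
    (hb : y * b * y = b) : a⁻¹ * b ∈ Subgroup.centralizer ({y} : Set G) := by
  rw [Subgroup.mem_centralizer_singleton_iff]
  have h : a⁻¹ * y⁻¹ = y * a⁻¹ := by
    rw [← mul_inv_rev, inv_eq_iff_eq_inv, mul_inv_rev, inv_inv, eq_mul_inv_iff_mul_eq, ha]
  have h' : b * y = y⁻¹ * b := by rw [eq_inv_mul_iff_mul_eq, ← mul_assoc, hb]
  rw [mul_assoc, h', ← mul_assoc, h, mul_assoc]

theorem IsConj.sq_eq_of_mem_center {G : Type*} [Group G] {t a : G} (h : IsConj t a)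
    (ht : t ^ 2 ∈ Subgroup.center G) : a ^ 2 = t ^ 2 := by
  obtain ⟨c, rfl⟩ := isConj_iff.mp h
  rw [conj_pow, Subgroup.mem_center_iff.mp ht c, mul_inv_cancel_right]

open Finset in
open Classical in
theorem card_isConj_mul_mem_le_card_centralizer {G : Type*} [Group G] [Fintype G] {t : G}
    (ht : t ^ 2 ∈ Subgroup.center G) (y : G) :
    #{a | IsConj t a ∧ IsConj t (a * y)} ≤ Nat.card (Subgroup.centralizer ({y} : Set G)) := by
  have hinv : ∀ a, IsConj t a ∧ IsConj t (a * y) → y * a * y = a := fun a ha =>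
    mul_mul_eq_of_sq_eq <| by rw [ha.1.sq_eq_of_mem_center ht, ha.2.sq_eq_of_mem_center ht]
  rcases ({a | IsConj t a ∧ IsConj t (a * y)} : Finset G).eq_empty_or_nonempty with he | ⟨a, ha⟩
  · rw [he, card_empty]
    exact Nat.zero_le _
  · rw [Nat.card_eq_fintype_card, Fintype.card_subtype]
    refine card_le_card_of_injOn (fun b => a⁻¹ * b) (fun b hb => ?_)
      fun _ _ _ _ h => mul_left_cancel h
    simpa using inv_mul_mem_centralizer (hinv a (by simpa [-isConj_iff] using ha)) (hinv b (by simpa [-isConj_iff] using hb))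

open Finset in
open Classical in
theorem sq_card_isConj_eq_sum {G : Type*} [Group G] [Fintype G] (t : G) :
    #{a | IsConj t a} ^ 2 = ∑ y : G, #{a | IsConj t a ∧ IsConj t (a * y)} := by
  rw [pow_two, ← card_product, card_eq_sum_card_fiberwise (f := fun p : G × G => p.1⁻¹ * p.2)
    (t := univ) fun _ _ => mem_univ _]
  refine sum_congr rfl fun y _ => card_bij (fun p _ => p.1) ?_ ?_ ?_
  · rintro ⟨a, b⟩ h
    simp only [mem_filter, mem_product, mem_univ, true_and] at h ⊢
    obtain ⟨⟨ha, hb⟩, rfl⟩ := h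
    simpa [-isConj_iff] using ⟨ha, hb⟩
  · rintro ⟨a, b⟩ h ⟨a', b'⟩ h' hab
    simp only [mem_filter] at h h' hab
    obtain rfl := hab
    simpa using h.2.trans h'.2.symm
  · intro a ha
    refine ⟨(a, a * y), ?_, rfl⟩
    simpa using ha

open Finset in
open Classical in
theorem sq_card_isConj_add_card_le {G : Type*} [Group G] [Fintype G] {t : G}
    (ht : t ^ 2 ∈ Subgroup.center G) {m : ℕ} (hm : 0 < m)
    (h : ∀ y : G, y ∉ Subgroup.center G →
      Nat.card (Subgroup.centralizer ({y} : Set G)) ≤ m) :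
    #{a | IsConj t a} ^ 2 + Nat.card G ≤
      Nat.card (Subgroup.center G) * #{a | IsConj t a} + m * Nat.card G := by
  have hcenter : ∑ y : G with y ∈ Subgroup.center G, #{a | IsConj t a ∧ IsConj t (a * y)} ≤
      Nat.card (Subgroup.center G) * #{a | IsConj t a} := by
    rw [Nat.card_eq_fintype_card, Fintype.card_subtype, ← smul_eq_mul]
    exact sum_le_card_nsmul _ _ _ fun y _ => card_le_card fun a => by simp +contextual
  have hnoncenter := sum_le_sum (s := {y : G | y ∉ Subgroup.center G})
    fun y _ => card_isConj_mul_mem_le_card_centralizer ht y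
  have hsum := sum_card_centralizer_add_card_le hm h
  rw [sq_card_isConj_eq_sum, ← sum_filter_add_sum_filter_not univ (· ∈ Subgroup.center G)]
  omega


/-- Let `G` be a finite non-abelian group, `t` non-central with `t^2` central, and `x`
non-central with centralizer of maximal order among centralizers of non-central elements.
Then `|G| ≤ |C_G(t)|^2 · (|C_G(x)| − 1 + |Z(G)|/|C_G(t)|)` (as rationals). -/
theorem stmt_14 (G : Type*) [Group G] [Finite G]
    (hna : ∃ a b : G, a * b ≠ b * a)
    (t : G) (ht : t ∉ Subgroup.center G) (ht2 : t ^ 2 ∈ Subgroup.center G)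
    (x : G) (hx : x ∉ Subgroup.center G)
    (hmax : ∀ y : G, y ∉ Subgroup.center G →
      Nat.card (Subgroup.centralizer ({y} : Set G)) ≤
        Nat.card (Subgroup.centralizer ({x} : Set G))) :
    (Nat.card G : ℚ) ≤ (Nat.card (Subgroup.centralizer ({t} : Set G)) : ℚ) ^ 2 *
      ((Nat.card (Subgroup.centralizer ({x} : Set G)) : ℚ) - 1 +
        (Nat.card (Subgroup.center G) : ℚ) /
          (Nat.card (Subgroup.centralizer ({t} : Set G)) : ℚ)) := by
  classical
  have := Fintype.ofFinite G
  have hbound := sq_card_isConj_add_card_le ht2 Nat.card_pos hmax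
  have hclass := card_isConj_mul_card_centralizer t
  have hc : 0 < Nat.card (Subgroup.centralizer ({t} : Set G)) := Nat.card_pos
  have hn : 0 < (Finset.univ.filter fun a => IsConj t a).card :=
    Finset.card_pos.mpr ⟨t, by simpa [-isConj_iff] using IsConj.refl t⟩
  rw [← hclass] at hbound ⊢
  generalize (Finset.univ.filter fun a => IsConj t a).card = n at *
  generalize Nat.card (Subgroup.centralizer ({t} : Set G)) = c at *
  generalize Nat.card (Subgroup.centralizer ({x} : Set G)) = m at *
  generalize Nat.card (Subgroup.center G) = z at *
  have hle : n + c ≤ z + m * c := by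
    refine le_of_mul_le_mul_left ?_ hn
    linarith
  have hle' : (n : ℚ) + c ≤ z + m * c := by exact_mod_cast hle
  have hc' : (0 : ℚ) < c := by exact_mod_cast hc
  have hrhs : (c : ℚ) ^ 2 * (m - 1 + z / c) = (z + m * c - c) * c := by
    field_simp
    ring
  rw [hrhs]
  push_cast
  exact mul_le_mul_of_nonneg_right (by linarith) hc'.le
end

section
/- Let F be a finite field of characteristic 2 with |F| = 2^n (n ≥ 1), and let G = SL(2,F) be the group of 2×2 matrices over F of determinant 1. Then the centralizer in G of any involution of G has order 2^n. -/
/-- In characteristic two, an involution of `SL(2, F)` has the form `!![a, b; c, a]` with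
`a ^ 2 + b * c = 1` and `b`, `c` not both zero. -/
lemma Matrix.SpecialLinearGroup.involution_entries {F : Type*} [Field F] [CharP F 2]
    {x : SpecialLinearGroup (Fin 2) F} (hx2 : x ^ 2 = 1) (hx1 : x ≠ 1) :
    x 1 1 = x 0 0 ∧ x 0 0 ^ 2 + x 0 1 * x 1 0 = 1 ∧ (x 0 1 ≠ 0 ∨ x 1 0 ≠ 0) := by
  have h : (x : Matrix (Fin 2) (Fin 2) F) * x = 1 := by
    rw [← SpecialLinearGroup.coe_mul, ← sq, hx2, SpecialLinearGroup.coe_one]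
  have h00 := congrFun (congrFun h 0) 0
  have h11 := congrFun (congrFun h 1) 1
  simp only [Matrix.mul_apply, Fin.sum_univ_two, Matrix.one_apply_eq] at h00 h11
  have hd : x 1 1 = x 0 0 := CharTwo.sq_inj.mp (by linear_combination h11 - h00)
  have hs : x 0 0 ^ 2 + x 0 1 * x 1 0 = 1 := by linear_combination h00
  refine ⟨hd, hs, ?_⟩
  by_contra! h0
  have ha : x 0 0 = 1 := CharTwo.sq_inj.mp (by linear_combination hs - x 1 0 * h0.1)
  apply hx1
  ext i j
  fin_cases i <;> fin_cases j <;> simp [h0, hd, ha]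

/-- In characteristic two, the centralizer of an involution `x` of `SL(2, F)` is parametrized by
`F` through `t ↦ 1 + t • (x - 1)`. -/
lemma Matrix.SpecialLinearGroup.card_centralizer_involution {F : Type*} [Field F] [CharP F 2]
    {x : SpecialLinearGroup (Fin 2) F} (hx2 : x ^ 2 = 1) (hx1 : x ≠ 1) :
    Nat.card (Subgroup.centralizer ({x} : Set (SpecialLinearGroup (Fin 2) F))) = Nat.card F := by
  have h2 : (2 : F) = 0 := CharTwo.two_eq_zero
  obtain ⟨hd, hs, hbc⟩ := involution_entries hx2 hx1
  set a := x 0 0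
  set b := x 0 1
  set c := x 1 0
  have hx : (x : Matrix (Fin 2) (Fin 2) F) = !![a, b; c, a] := by
    rw [Matrix.eta_fin_two (x : Matrix (Fin 2) (Fin 2) F), hd]
  let f (t : F) : SpecialLinearGroup (Fin 2) F :=
    ⟨!![1 + t * (a + 1), t * b; t * c, 1 + t * (a + 1)], by
      rw [Matrix.det_fin_two_of]
      linear_combination t ^ 2 * hs + (t * (a + 1) + t ^ 2 * (a + 1) - t ^ 2 * b * c) * h2⟩
  have hf (t : F) : f t ∈ Subgroup.centralizer {x} := by
    rw [Subgroup.mem_centralizer_singleton_iff]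
    apply Subtype.ext
    change !![1 + t * (a + 1), t * b; t * c, 1 + t * (a + 1)] * (x : Matrix (Fin 2) (Fin 2) F) =
      (x : Matrix (Fin 2) (Fin 2) F) * !![1 + t * (a + 1), t * b; t * c, 1 + t * (a + 1)]
    rw [hx, Matrix.mul_fin_two, Matrix.mul_fin_two]
    congr! 4 <;> ring_nf
  refine (Nat.card_eq_of_bijective (fun t : F ↦ (⟨f t, hf t⟩ : Subgroup.centralizer {x}))
    ⟨fun t u htu ↦ ?_, fun ⟨y, hy⟩ ↦ ?_⟩).symm
  · have h : (f t : Matrix (Fin 2) (Fin 2) F) = f u :=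
      congrArg Subtype.val (congrArg Subtype.val htu)
    have h01 : t * b = u * b := congrFun (congrFun h 0) 1
    have h10 : t * c = u * c := congrFun (congrFun h 1) 0
    exact hbc.elim (fun hb ↦ mul_right_cancel₀ hb h01) (fun hc ↦ mul_right_cancel₀ hc h10)
  · rw [Subgroup.mem_centralizer_singleton_iff] at hy
    have h : (y : Matrix (Fin 2) (Fin 2) F) * x = x * y := by
      rw [← SpecialLinearGroup.coe_mul, hy, SpecialLinearGroup.coe_mul]
    have h00 := congrFun (congrFun h 0) 0
    have h01 := congrFun (congrFun h 0) 1
    have h10 := congrFun (congrFun h 1) 0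
    have hdet := y.det_coe
    rw [Matrix.det_fin_two] at hdet
    simp only [hx, Matrix.mul_apply, Fin.sum_univ_two, Matrix.of_apply, Matrix.cons_val_zero,
      Matrix.cons_val_one] at h00 h01 h10
    have hyd : y 1 1 = y 0 0 := hbc.elim
      (fun hb ↦ mul_left_cancel₀ hb (by linear_combination -h01))
      (fun hc ↦ mul_left_cancel₀ hc (by linear_combination h10))
    obtain ⟨t, htb, htc⟩ : ∃ t, t * b = y 0 1 ∧ t * c = y 1 0 := by
      rcases hbc with hb | hc
      · refine ⟨y 0 1 / b, by field_simp, ?_⟩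
        field_simp
        linear_combination h00
      · refine ⟨y 1 0 / c, ?_, by field_simp⟩
        field_simp
        linear_combination -h00
    have hta : 1 + t * (a + 1) = y 0 0 := CharTwo.sq_inj.mp (by
      rw [hyd, ← htb, ← htc] at hdet
      linear_combination t ^ 2 * hs - hdet + (t * (a + 1) + t ^ 2 * a + t ^ 2 - t ^ 2 * b * c) * h2)
    refine ⟨t, Subtype.ext (Subtype.ext ?_)⟩
    change !![1 + t * (a + 1), t * b; t * c, 1 + t * (a + 1)] = (y : Matrix (Fin 2) (Fin 2) F)
    rw [Matrix.eta_fin_two (y : Matrix (Fin 2) (Fin 2) F), hyd, hta, htb, htc]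

/-- Let `F` be a finite field of characteristic 2 with `|F| = 2^n` (`n ≥ 1`), and let
`G = SL(2,F)`. Then the centralizer in `G` of any involution of `G` has order `2^n`. -/
theorem stmt_15 (F : Type*) [Field F] [Fintype F] [CharP F 2] (n : ℕ) (hn : 1 ≤ n)
    (hF : Fintype.card F = 2 ^ n)
    (x : Matrix.SpecialLinearGroup (Fin 2) F) (hx2 : x ^ 2 = 1) (hx1 : x ≠ 1) :
    Nat.card (Subgroup.centralizer ({x} : Set (Matrix.SpecialLinearGroup (Fin 2) F))) =
      2 ^ n := by
  rw [Matrix.SpecialLinearGroup.card_centralizer_involution hx2 hx1,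
    Nat.card_eq_fintype_card, hF]
end

section
/- Let F be a finite field of characteristic 2 with |F| = 2^n (n ≥ 1), and let G = SL(2,F). Then for every non-identity element x of G, the centralizer of x in G has order at most 2^n + 1. -/
/-- A 2×2 matrix commuting with a non-scalar matrix `A` is of the form `u + v A`. -/
theorem Matrix.exists_eq_smul_one_add_smul_of_commute {K : Type*} [Field K]
    {A B : Matrix (Fin 2) (Fin 2) K}
    (hA : ¬(A 0 1 = 0 ∧ A 1 0 = 0 ∧ A 0 0 = A 1 1)) (h : Commute A B) :
    ∃ u v : K, B = u • (1 : Matrix (Fin 2) (Fin 2) K) + v • A := by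
  have h00 := congrFun (congrFun h.eq 0) 0
  have h01 := congrFun (congrFun h.eq 0) 1
  have h10 := congrFun (congrFun h.eq 1) 0
  simp only [Matrix.mul_apply, Fin.sum_univ_two] at h00 h01 h10
  suffices ∃ v, B 0 1 = v * A 0 1 ∧ B 1 0 = v * A 1 0 ∧
      B 0 0 - B 1 1 = v * (A 0 0 - A 1 1) by
    obtain ⟨v, h1, h2, h3⟩ := this
    refine ⟨B 0 0 - v * A 0 0, v, ?_⟩
    ext i j
    fin_cases i <;> fin_cases j <;> simp [h1, h2]
    linear_combination -h3
  by_cases hb : A 0 1 = 0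
  · by_cases hc : A 1 0 = 0
    · have hd : A 0 0 - A 1 1 ≠ 0 := fun hd => hA ⟨hb, hc, sub_eq_zero.mp hd⟩
      refine ⟨(B 0 0 - B 1 1) / (A 0 0 - A 1 1), ?_, ?_, by field_simp⟩
      · apply mul_left_cancel₀ hd
        field_simp
        linear_combination h01
      · apply mul_left_cancel₀ hd
        field_simp
        linear_combination -h10
    · refine ⟨B 1 0 / A 1 0, ?_, by field_simp, ?_⟩
      · field_simp
        linear_combination -h00
      · field_simp
        linear_combination h10
  · refine ⟨B 0 1 / A 0 1, by field_simp, ?_, ?_⟩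
    · field_simp
      linear_combination h00
    · field_simp
      linear_combination -h01

/-- In characteristic 2, the affine conic `u² + t u v + v² = 1` has at most `|K| + 1` points. -/
theorem card_conic_le_of_charP_two {K : Type*} [Field K] [Finite K] [CharP K 2] (t : K) :
    Nat.card {p : K × K // p.1 ^ 2 + t * p.1 * p.2 + p.2 ^ 2 = 1} ≤ Nat.card K + 1 := by
  classical
  have h2 : (2 : K) = 0 := CharTwo.two_eq_zero
  rw [← Finite.card_option]
  by_cases ht : t = 0
  · apply Nat.card_le_card_of_injective
      (fun p : {p : K × K // p.1 ^ 2 + t * p.1 * p.2 + p.2 ^ 2 = 1} => some p.1.2)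
    rintro ⟨⟨u, v⟩, h⟩ ⟨⟨u', v'⟩, h'⟩ hv
    obtain rfl : v = v' := by simpa using hv
    simp only [ht] at h h'
    have : (u - u') ^ 2 = 0 := by
      linear_combination h - h' + (u' ^ 2 - u * u') * h2
    have := sub_eq_zero.mp (pow_eq_zero_iff two_ne_zero |>.mp this)
    simp [this]
  · -- Project from the point `(1, 0)`.
    apply Nat.card_le_card_of_injective
      (fun p : {p : K × K // p.1 ^ 2 + t * p.1 * p.2 + p.2 ^ 2 = 1} =>
        if p.1.2 = 0 then none else some ((p.1.1 - 1) / p.1.2))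
    have at_zero {u : K} (h : u ^ 2 + t * u * 0 + 0 ^ 2 = 1) : u = 1 := by
      have : (u - 1) ^ 2 = 0 := by linear_combination h + (1 - u) * h2
      exact sub_eq_zero.mp (pow_eq_zero_iff two_ne_zero |>.mp this)
    have slope {u v : K} (hv : v ≠ 0) (h : u ^ 2 + t * u * v + v ^ 2 = 1) :
        v * (((u - 1) / v) ^ 2 + t * ((u - 1) / v) + 1) = t := by
      field_simp
      linear_combination h + (1 - u - t * v) * h2
    rintro ⟨⟨u, v⟩, h⟩ ⟨⟨u', v'⟩, h'⟩ huv
    dsimp only at h h' huv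
    by_cases hv : v = 0 <;> by_cases hv' : v' = 0
    · subst hv hv'
      simp [at_zero h, at_zero h']
    · simp [hv, hv'] at huv
    · simp [hv, hv'] at huv
    · simp only [hv, hv', if_false, Option.some.injEq] at huv
      have e := slope hv h
      have e' := slope hv' h'
      rw [← huv] at e'
      have hne : ((u - 1) / v) ^ 2 + t * ((u - 1) / v) + 1 ≠ 0 := fun h0 => by
        rw [h0, mul_zero] at e
        exact ht e.symm
      obtain rfl : v = v' := mul_right_cancel₀ hne (e.trans e'.symm)
      have hu : u = u' := by simpa using (div_left_inj' hv).mp huv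
      simp [hu]


/-- Let `F` be a finite field of characteristic 2 with `|F| = 2^n` (`n ≥ 1`), and let
`G = SL(2,F)`. Then for every non-identity `x ∈ G`, the centralizer of `x` in `G` has
order at most `2^n + 1`. -/
theorem stmt_16 (F : Type*) [Field F] [Fintype F] [CharP F 2] (n : ℕ) (hn : 1 ≤ n)
    (hF : Fintype.card F = 2 ^ n)
    (x : Matrix.SpecialLinearGroup (Fin 2) F) (hx1 : x ≠ 1) :
    Nat.card (Subgroup.centralizer ({x} : Set (Matrix.SpecialLinearGroup (Fin 2) F))) ≤
      2 ^ n + 1 := by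
  have h2 : (2 : F) = 0 := CharTwo.two_eq_zero
  have hdet := x.det_coe
  rw [Matrix.det_fin_two] at hdet
  have hx : ¬(x.1 0 1 = 0 ∧ x.1 1 0 = 0 ∧ x.1 0 0 = x.1 1 1) := by
    rintro ⟨hb, hc, hd⟩
    rw [hb, hd] at hdet
    have h1 : x.1 1 1 = 1 := by
      have : (x.1 1 1 - 1) ^ 2 = 0 := by
        linear_combination hdet + (1 - x.1 1 1) * h2
      exact sub_eq_zero.mp (pow_eq_zero_iff two_ne_zero |>.mp this)
    apply hx1
    ext i j
    fin_cases i <;> fin_cases j <;> simp [hb, hc, hd, h1]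
  have hcomb (g : Subgroup.centralizer ({x} : Set (Matrix.SpecialLinearGroup (Fin 2) F))) :
      ∃ u v : F, g.1.1 = u • (1 : Matrix (Fin 2) (Fin 2) F) + v • x.1 :=
    Matrix.exists_eq_smul_one_add_smul_of_commute hx
      (congrArg Subtype.val (Subgroup.mem_centralizer_singleton_iff.mp g.2).symm)
  choose u v huv using hcomb
  rw [← hF, ← Nat.card_eq_fintype_card]
  refine le_trans ?_ (card_conic_le_of_charP_two x.1.trace)
  refine Nat.card_le_card_of_injective (fun g => ⟨(u g, v g), ?_⟩) fun g g' h => ?_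
  · have hg := g.1.det_coe
    rw [huv g, Matrix.det_fin_two] at hg
    simp at hg
    rw [Matrix.trace_fin_two]
    linear_combination hg - v g ^ 2 * hdet
  · simp only [Subtype.mk.injEq, Prod.mk.injEq] at h
    apply Subtype.ext
    apply Subtype.ext
    rw [huv g, huv g', h.1, h.2]
end
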